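/- arXiv:0808.2881 — 7 statements merged into one kernel-verified Lean document; each statement's English description precedes it below -/
import Mathlib

section
/- The Closed Infinite Broom B is a continuum: B is a nonempty, compact, and connected subset of ℝ². -/
open Set

/-- The `n`-th hair of the broom: `H n = {(t, t/2^n) : t ∈ [0,1]}`. -/
def hair (n : ℕ) : Set (ℝ × ℝ) := {p | ∃ t ∈ Icc (0:ℝ) 1, p = (t, t / 2 ^ n)}

/-- The Closed Infinite Broom `B = ([0,1] × {0}) ∪ ⋃ₙ H n`. -/
def broom : Set (ℝ × ℝ) := (Icc (0:ℝ) 1 ×ˢ ({0} : Set ℝ)) ∪ ⋃ n, hair n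

/-- The broom is the image of `[0,1] × {0, 1, 1/2, 1/4, …}` under `(t, s) ↦ (t, t * s)`. -/
theorem broom_eq_image :
    broom = (fun p : ℝ × ℝ => (p.1, p.1 * p.2)) ''
      (Icc (0:ℝ) 1 ×ˢ insert 0 (range fun n : ℕ => (1 / 2 : ℝ) ^ n)) := by
  ext ⟨x, y⟩
  simp only [broom, hair, mem_union, mem_prod, mem_singleton_iff, mem_iUnion, mem_ofPred_eq,
    mem_image, mem_insert_iff, mem_range, Prod.mk.injEq, Prod.exists]
  constructor
  · rintro (⟨hx, rfl⟩ | ⟨n, t, ht, rfl, rfl⟩)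
    · exact ⟨x, 0, ⟨hx, Or.inl rfl⟩, rfl, mul_zero x⟩
    · exact ⟨x, (1 / 2) ^ n, ⟨ht, Or.inr ⟨n, rfl⟩⟩, rfl, by rw [one_div_pow, mul_one_div]⟩
  · rintro ⟨t, s, ⟨ht, rfl | ⟨n, rfl⟩⟩, rfl, rfl⟩
    · exact Or.inl ⟨ht, mul_zero t⟩
    · exact Or.inr ⟨n, t, ht, rfl, by rw [one_div_pow, mul_one_div]⟩

theorem isCompact_broom : IsCompact broom := by
  have h : Filter.Tendsto (fun n : ℕ => (1 / 2 : ℝ) ^ n) Filter.atTop (nhds 0) :=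
    tendsto_pow_atTop_nhds_zero_of_lt_one (by norm_num) (by norm_num)
  rw [broom_eq_image]
  exact (isCompact_Icc.prod h.isCompact_insert_range).image (by fun_prop)

theorem starConvex_broom : StarConvex ℝ 0 broom := by
  rw [starConvex_zero_iff, broom_eq_image]
  rintro _ ⟨⟨t, s⟩, ⟨ht, hs⟩, rfl⟩ a ha₀ ha₁
  exact ⟨(a * t, s), ⟨⟨mul_nonneg ha₀ ht.1, mul_le_one₀ ha₁ ht.1 ht.2⟩, hs⟩, by
    simp [mul_assoc]⟩

theorem zero_mem_broom : (0 : ℝ × ℝ) ∈ broom :=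
  Or.inl ⟨⟨le_rfl, zero_le_one⟩, rfl⟩

/-- The Closed Infinite Broom is a continuum: nonempty, compact and connected. -/
theorem broom_is_continuum :
    broom.Nonempty ∧ IsCompact broom ∧ IsConnected broom := by
  exact ⟨⟨0, zero_mem_broom⟩, isCompact_broom,
    (starConvex_broom.isPathConnected zero_mem_broom).isConnected⟩
end

section
/- The map f : X → Y given by f(x,y) = (x,y) for (x,y) ∈ B and f(0,y) = (y,0) for points (0,y) with y ∈ [0,2] is well defined (the two clauses agree at (0,0) and its values lie in Y), continuous, and surjective onto Y. -/
open Set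

/-- The range space `Y = B ∪ ([1,2] × {0})`. -/
def Yset : Set (ℝ × ℝ) := broom ∪ (Icc (1:ℝ) 2 ×ˢ ({0} : Set ℝ))

/-- The domain space `X = B ∪ ({0} × [0,2])`. -/
def Xset : Set (ℝ × ℝ) := broom ∪ (({0} : Set ℝ) ×ˢ Icc (0:ℝ) 2)

open Classical in
/-- The map `f` : the identity on `B` and the rotation `(0,y) ↦ (y,0)` on the
extra hair `{0} × [0,2]`. -/
noncomputable def fFun : ℝ × ℝ → ℝ × ℝ := fun p => if p ∈ broom then p else p.swap

/-- The broom lies below the diagonal. -/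
lemma snd_le_fst_of_mem_broom {p : ℝ × ℝ} (hp : p ∈ broom) : p.2 ≤ p.1 := by
  rcases hp with ⟨h1, h2⟩ | hp
  · rw [mem_singleton_iff.1 h2]
    exact h1.1
  · obtain ⟨n, t, ht, rfl⟩ := mem_iUnion.1 hp
    exact div_le_self ht.1 (one_le_pow₀ one_le_two)

lemma snd_nonneg_of_mem_broom {p : ℝ × ℝ} (hp : p ∈ broom) : 0 ≤ p.2 := by
  rcases hp with ⟨_, h2⟩ | hp
  · exact (mem_singleton_iff.1 h2).ge
  · obtain ⟨n, t, ht, rfl⟩ := mem_iUnion.1 hp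
    exact div_nonneg ht.1 (by positivity)

lemma mk_zero_mem_broom {t : ℝ} (ht : t ∈ Icc (0:ℝ) 1) : (t, (0:ℝ)) ∈ broom :=
  Or.inl ⟨ht, rfl⟩

lemma fFun_of_mem_broom {p : ℝ × ℝ} (hp : p ∈ broom) : fFun p = p := if_pos hp

lemma swap_eq_self_of_mem_broom {p : ℝ × ℝ} (hp : p ∈ broom) (h : p.1 = 0) : p.swap = p := by
  have h2 : p.2 = 0 :=
    le_antisymm ((snd_le_fst_of_mem_broom hp).trans h.le) (snd_nonneg_of_mem_broom hp)
  exact Prod.ext (h2.trans h.symm) (h.trans h2.symm)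

lemma fFun_zero_mk (y : ℝ) : fFun (0, y) = (y, 0) := by
  by_cases h : ((0:ℝ), y) ∈ broom
  · rw [fFun_of_mem_broom h]
    exact (swap_eq_self_of_mem_broom h rfl).symm
  · exact if_neg h

/-- On `X`, the map `f` sorts the two coordinates in decreasing order. -/
lemma fFun_eqOn_max_min : EqOn fFun (fun p => (max p.1 p.2, min p.1 p.2)) Xset := by
  rintro ⟨x, y⟩ (hp | ⟨hx, hy⟩)
  · have h : y ≤ x := snd_le_fst_of_mem_broom hp
    simp [fFun_of_mem_broom hp, h]
  · obtain rfl : x = 0 := hx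
    have h : 0 ≤ y := hy.1
    simp [fFun_zero_mk, h]

/-- `f : X → Y` is well defined (the identity clause and the swap clause agree on the
overlap of `B` with the extra hair `{0} × [0,2]`, and `f` maps `X` into `Y`),
continuous on `X`, and surjective onto `Y`. -/
theorem fFun_wellDefined_continuous_surjective :
    (∀ p : ℝ × ℝ, p ∈ broom → p ∈ (({0} : Set ℝ) ×ˢ Icc (0:ℝ) 2) → p.swap = p) ∧
    Set.MapsTo fFun Xset Yset ∧
    ContinuousOn fFun Xset ∧
    Set.SurjOn fFun Xset Yset := by
  refine ⟨fun p hp hq => swap_eq_self_of_mem_broom hp hq.1, ?_, ?_, ?_⟩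
  · rintro ⟨x, y⟩ (hp | ⟨hx, hy⟩)
    · rw [fFun_of_mem_broom hp]
      exact Or.inl hp
    · obtain rfl : x = 0 := hx
      rw [fFun_zero_mk]
      rcases le_total y 1 with h | h
      · exact Or.inl (mk_zero_mem_broom ⟨hy.1, h⟩)
      · exact Or.inr ⟨⟨h, hy.2⟩, rfl⟩
  · exact ContinuousOn.congr (by fun_prop) fFun_eqOn_max_min
  · rintro ⟨x, y⟩ (hp | ⟨hx, hy⟩)
    · exact ⟨_, Or.inl hp, fFun_of_mem_broom hp⟩
    · obtain rfl : y = 0 := hy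
      exact ⟨(0, x), Or.inr ⟨rfl, zero_le_one.trans hx.1, hx.2⟩, fFun_zero_mk x⟩
end

section
/- For the subcontinuum C = [1,2] × {0} of Y, the preimage f⁻¹(C) equals ({0} × [1,2]) ∪ {(1,0)}, and the connected component of the point (1,0) in f⁻¹(C) (with the subspace topology) is the singleton {(1,0)}. -/
open Set

/-- The subcontinuum `C = [1,2] × {0}` of `Y`. -/
def Cseg : Set (ℝ × ℝ) := Icc (1:ℝ) 2 ×ˢ ({0} : Set ℝ)

theorem fst_mem_Icc_of_mem_broom {p : ℝ × ℝ} (hp : p ∈ broom) : p.1 ∈ Icc (0:ℝ) 1 := by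
  rcases hp with hp | hp
  · exact hp.1
  · obtain ⟨n, t, ht, rfl⟩ := mem_iUnion.1 hp
    exact ht

theorem snd_eq_zero_of_mem_broom {p : ℝ × ℝ} (hp : p ∈ broom) (h : p.1 = 0) : p.2 = 0 := by
  rcases hp with hp | hp
  · exact hp.2
  · obtain ⟨n, t, ht, rfl⟩ := mem_iUnion.1 hp
    simp_all

theorem one_zero_mem_broom : ((1:ℝ), (0:ℝ)) ∈ broom :=
  Or.inl ⟨by simp, rfl⟩

theorem Xset_inter_preimage_Cseg :
    Xset ∩ fFun ⁻¹' Cseg = (({0} : Set ℝ) ×ˢ Icc (1:ℝ) 2) ∪ {((1:ℝ), (0:ℝ))} := by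
  ext ⟨x, y⟩
  constructor
  · rintro ⟨hX, hC⟩
    by_cases hb : (x, y) ∈ broom
    · rw [mem_preimage, fFun, if_pos hb] at hC
      exact Or.inr (Prod.ext (le_antisymm (fst_mem_Icc_of_mem_broom hb).2 hC.1.1) hC.2)
    · rw [mem_preimage, fFun, if_neg hb] at hC
      exact Or.inl ⟨hC.2, hC.1⟩
  · rintro (⟨hx, hy⟩ | h)
    · have hb : (x, y) ∉ broom := fun hb => by
        have h0 : y = 0 := snd_eq_zero_of_mem_broom hb hx
        have h1 : 1 ≤ y := hy.1
        linarith
      refine ⟨Or.inr ⟨hx, zero_le_one.trans hy.1, hy.2⟩, ?_⟩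
      rw [mem_preimage, fFun, if_neg hb]
      exact ⟨hy, hx⟩
    · rw [mem_singleton_iff.1 h]
      refine ⟨Or.inl one_zero_mem_broom, ?_⟩
      rw [mem_preimage, fFun, if_pos one_zero_mem_broom]
      exact ⟨by simp, rfl⟩

theorem connectedComponentIn_vertical_union_singleton :
    connectedComponentIn ((({0} : Set ℝ) ×ˢ Icc (1:ℝ) 2) ∪ {((1:ℝ), (0:ℝ))}) ((1:ℝ), (0:ℝ)) =
      {((1:ℝ), (0:ℝ))} := by
  set S : Set (ℝ × ℝ) := (({0} : Set ℝ) ×ˢ Icc (1:ℝ) 2) ∪ {((1:ℝ), (0:ℝ))}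
  have hmem : ((1:ℝ), (0:ℝ)) ∈ connectedComponentIn S ((1:ℝ), (0:ℝ)) :=
    mem_connectedComponentIn (Or.inr rfl)
  refine Subset.antisymm (fun p hp => ?_) (singleton_subset_iff.2 hmem)
  rcases connectedComponentIn_subset _ _ hp with h | h
  · have hconn := (isPreconnected_connectedComponentIn (F := S) (x := ((1:ℝ), (0:ℝ)))).image
      Prod.fst continuous_fst.continuousOn
    have h0 : p.1 = 0 := h.1
    obtain ⟨q, hq, hq2⟩ := hconn.ordConnected.out (mem_image_of_mem _ hp)
      (mem_image_of_mem _ hmem) (show (1 / 2 : ℝ) ∈ Icc p.1 1 by rw [h0]; norm_num)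
    rcases connectedComponentIn_subset _ _ hq with h' | h'
    · have hq0 : q.1 = 0 := h'.1
      norm_num [hq0] at hq2
    · rw [mem_singleton_iff.1 h'] at hq2
      norm_num at hq2
  · exact h

/-- The preimage `f⁻¹(C)` (as a subset of `X`) equals `({0} × [1,2]) ∪ {(1,0)}`,
and the connected component of `(1,0)` in this preimage is the singleton `{(1,0)}`. -/
theorem preimage_eq_and_component_singleton :
    Xset ∩ fFun ⁻¹' Cseg = (({0} : Set ℝ) ×ˢ Icc (1:ℝ) 2) ∪ {((1:ℝ), (0:ℝ))} ∧
    connectedComponentIn (Xset ∩ fFun ⁻¹' Cseg) ((1:ℝ), (0:ℝ)) = {((1:ℝ), (0:ℝ))} := by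
  refine ⟨Xset_inter_preimage_Cseg, ?_⟩
  rw [Xset_inter_preimage_Cseg]
  exact connectedComponentIn_vertical_union_singleton
end

section
/- The map f : X → Y is not confluent: there exists a nonempty compact connected subset C of Y (namely C = [1,2] × {0}) and a connected component K of f⁻¹(C) (namely K = {(1,0)}) such that the image f(K) is not equal to C. -/
open Set

/-- Over `[1,2] × {0}` the domain only has points of abscissa `0` or at least `1`. -/
theorem fst_eq_zero_or_one_le {p : ℝ × ℝ}
    (hp : p ∈ Xset ∩ fFun ⁻¹' (Icc (1:ℝ) 2 ×ˢ ({0} : Set ℝ))) : p.1 = 0 ∨ 1 ≤ p.1 := by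
  obtain ⟨hX, hf⟩ := hp
  by_cases hb : p ∈ broom
  · rw [mem_preimage, fFun, if_pos hb] at hf
    exact Or.inr hf.1.1
  · exact Or.inl (hX.resolve_left hb).1

/-- `f : X → Y` is not confluent: there is a nonempty compact connected subset `C`
of `Y` and a connected component `K` of `f⁻¹(C)` whose image under `f` is not `C`. -/
theorem fFun_not_confluent :
    ∃ C : Set (ℝ × ℝ), C ⊆ Yset ∧ C.Nonempty ∧ IsCompact C ∧ IsConnected C ∧
      ∃ x ∈ Xset ∩ fFun ⁻¹' C,
        fFun '' connectedComponentIn (Xset ∩ fFun ⁻¹' C) x ≠ C := by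
  have hbroom : ((1, 0) : ℝ × ℝ) ∈ broom := Or.inl (by simp)
  have hmem : ((1, 0) : ℝ × ℝ) ∈ Xset ∩ fFun ⁻¹' (Icc (1:ℝ) 2 ×ˢ ({0} : Set ℝ)) := by
    refine ⟨Or.inl hbroom, ?_⟩
    rw [mem_preimage, fFun, if_pos hbroom]
    simp
  have hconn : IsConnected (Icc (1:ℝ) 2 ×ˢ ({0} : Set ℝ)) :=
    (isConnected_Icc (by norm_num)).prod isConnected_singleton
  refine ⟨Icc (1:ℝ) 2 ×ˢ {0}, subset_union_right, hconn.nonempty,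
    isCompact_Icc.prod isCompact_singleton, hconn, (1, 0), hmem, fun heq => ?_⟩
  have htwo : ((2, 0) : ℝ × ℝ) ∈ Icc (1:ℝ) 2 ×ˢ ({0} : Set ℝ) := by simp
  rw [← heq] at htwo
  obtain ⟨p, hpK, hp⟩ := htwo
  have hp_not : p ∉ broom := fun hb => by
    rw [fFun, if_pos hb] at hp
    have := (fst_mem_Icc_of_mem_broom hb).2
    norm_num [hp] at this
  have hp_fst : p.1 = 0 :=
    ((connectedComponentIn_subset _ _ hpK).1.resolve_left hp_not).1
  obtain ⟨q, hqK, hq⟩ := isPreconnected_connectedComponentIn.intermediate_value hpK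
    (mem_connectedComponentIn hmem) continuous_fst.continuousOn
    (show (1 / 2 : ℝ) ∈ Icc p.1 1 by rw [hp_fst]; norm_num)
  have hq' := fst_eq_zero_or_one_le (connectedComponentIn_subset _ _ hqK)
  norm_num [hq] at hq'
end

section
/- Co-diagonal maps are weakly confluent: let Z be a continuum (nonempty compact connected Hausdorff space), I a nonempty discrete type, u an ultrafilter on I, and C a nonempty compact connected subset of Z. Then there is a connected component of q_u⁻¹(C) that q_u maps onto C; indeed, the component containing the (nonempty) set Z_u ∩ cl_{β(Z×I)}(ι(C × I)) is mapped onto C, where ι : Z × I → β(Z × I) is the canonical map into the Stone–Čech compactification. -/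
open Set

section Ultracopower

variable (Z I : Type*) [TopologicalSpace Z] [CompactSpace Z] [T2Space Z]
  [TopologicalSpace I] [DiscreteTopology I]

/-- The Stone–Čech extension `βπ_I : β(Z × I) → Ultrafilter I` of `(z,i) ↦ pure i`. -/
noncomputable def betaPiI : StoneCech (Z × I) → Ultrafilter I :=
  stoneCechExtend (show Continuous fun p : Z × I => (pure p.2 : Ultrafilter I) from
    continuous_of_discreteTopology.comp continuous_snd)

/-- The Stone–Čech extension `βπ_Z : β(Z × I) → Z` of the projection `(z,i) ↦ z`. -/
noncomputable def betaPiZ : StoneCech (Z × I) → Z :=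
  stoneCechExtend (show Continuous fun p : Z × I => p.1 from continuous_fst)

/-- The ultracopower `Z_u = βπ_I⁻¹({u})` of `Z` by the ultrafilter `u` on `I`. -/
noncomputable def ultraCopower (u : Ultrafilter I) : Set (StoneCech (Z × I)) :=
  betaPiI Z I ⁻¹' {u}

end Ultracopower

open Filter Topology

section Ultracopower

variable {Z I : Type*} [TopologicalSpace Z] [TopologicalSpace I]

section FirstProjection

variable [CompactSpace Z] [T2Space Z]

theorem continuous_betaPiZ : Continuous (betaPiZ Z I) :=
  continuous_stoneCechExtend _

@[simp]
theorem betaPiZ_stoneCechUnit (p : Z × I) : betaPiZ Z I (stoneCechUnit p) = p.1 :=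
  stoneCechExtend_stoneCechUnit _ p

theorem closure_subset_preimage_betaPiZ {C : Set Z} (hC : IsClosed C) :
    closure (stoneCechUnit '' (C ×ˢ (univ : Set I))) ⊆ betaPiZ Z I ⁻¹' C := by
  refine closure_minimal ?_ (hC.preimage continuous_betaPiZ)
  rintro _ ⟨p, hp, rfl⟩
  simpa using hp.1

end FirstProjection

variable [DiscreteTopology I]

theorem continuous_betaPiI : Continuous (betaPiI Z I) :=
  continuous_stoneCechExtend _

@[simp]
theorem betaPiI_stoneCechUnit (p : Z × I) : betaPiI Z I (stoneCechUnit p) = pure p.2 :=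
  stoneCechExtend_stoneCechUnit _ p

theorem isClosed_ultraCopower (u : Ultrafilter I) : IsClosed (ultraCopower Z I u) :=
  isClosed_singleton.preimage continuous_betaPiI

/-- A point of `Z_u` in the closure of `C × I` is already in the closure of `C × J`, for every
`J ∈ u`. -/
theorem ultraCopower_inter_closure_subset {u : Ultrafilter I} (C : Set Z) {J : Set I}
    (hJ : J ∈ u) :
    ultraCopower Z I u ∩ closure (stoneCechUnit '' (C ×ˢ (univ : Set I))) ⊆
      closure (stoneCechUnit '' (C ×ˢ J)) := by
  rintro x ⟨hxu, hx⟩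
  have hxu : betaPiI Z I x = u := hxu
  rw [mem_closure_iff] at hx ⊢
  intro N hN hxN
  obtain ⟨_, ⟨hyN, hyJ⟩, ⟨c, i⟩, hci, rfl⟩ := hx (N ∩ betaPiI Z I ⁻¹' {v | J ∈ v})
    (hN.inter ((ultrafilter_isOpen_basic J).preimage continuous_betaPiI))
    ⟨hxN, by simpa [hxu] using hJ⟩
  exact ⟨_, hyN, (c, i), ⟨hci.1, by simpa using hyJ⟩, rfl⟩

/-- An open neighbourhood of `Z_u ∩ K`, with `K` closed, contains the part of `K` lying over some
`J ∈ u`. -/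
theorem exists_mem_of_ultraCopower_inter_subset {u : Ultrafilter I}
    {K W : Set (StoneCech (Z × I))} (hK : IsClosed K) (hW : IsOpen W)
    (h : ultraCopower Z I u ∩ K ⊆ W) :
    ∃ J ∈ u, ∀ x ∈ K, J ∈ betaPiI Z I x → x ∈ W := by
  have hcl : IsClosed (betaPiI Z I '' (K \ W)) :=
    ((hK.sdiff hW).isCompact.image continuous_betaPiI).isClosed
  have hu : u ∈ (betaPiI Z I '' (K \ W))ᶜ := by
    rintro ⟨x, ⟨hxK, hxW⟩, hx⟩
    exact hxW (h ⟨hx, hxK⟩)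
  obtain ⟨_, ⟨J, rfl⟩, hJ, hsub⟩ :=
    ultrafilterBasis_is_basis.exists_subset_of_mem_open hu hcl.isOpen_compl
  exact ⟨J, hJ, fun x hxK hx => by_contra fun hxW => hsub hx ⟨x, ⟨hxK, hxW⟩, rfl⟩⟩

theorem isPreconnected_ultraCopower_inter_closure (u : Ultrafilter I) {C : Set Z}
    (hC : IsPreconnected C) :
    IsPreconnected
      (ultraCopower Z I u ∩ closure (stoneCechUnit '' (C ×ˢ (univ : Set I)))) := by
  rw [isPreconnected_iff_subset_of_fully_disjoint_closed
    ((isClosed_ultraCopower u).inter isClosed_closure)]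
  intro A B hA hB hAB hdisj
  obtain ⟨U, V, hU, hV, hAU, hBV, hUV⟩ := normal_separation hA hB hdisj
  obtain ⟨J, hJ, hJW⟩ := exists_mem_of_ultraCopower_inter_subset isClosed_closure
    (hU.union hV) (hAB.trans (union_subset_union hAU hBV))
  have hslice (i : I) : IsPreconnected (stoneCechUnit '' (C ×ˢ {i})) :=
    (hC.prod isPreconnected_singleton).image _ continuous_stoneCechUnit.continuousOn
  have hcover : {i | stoneCechUnit '' (C ×ˢ {i}) ⊆ U} ∪
      {i | stoneCechUnit '' (C ×ˢ {i}) ⊆ V} ∈ u := by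
    refine mem_of_superset hJ fun i hi => ?_
    refine isPreconnected_iff_subset_of_disjoint.1 (hslice i) U V hU hV ?_
      (by rw [hUV.inter_eq, inter_empty])
    rintro _ ⟨⟨c, j⟩, ⟨hc, rfl⟩, rfl⟩
    exact hJW _ (subset_closure ⟨_, ⟨hc, mem_univ _⟩, rfl⟩) (by simpa using hi)
  have hclosure {W : Set (StoneCech (Z × I))}
      (hW : {i | stoneCechUnit '' (C ×ˢ {i}) ⊆ W} ∈ u) :
      ultraCopower Z I u ∩ closure (stoneCechUnit '' (C ×ˢ (univ : Set I))) ⊆ closure W := by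
    refine (ultraCopower_inter_closure_subset C hW).trans (closure_mono ?_)
    rintro _ ⟨⟨c, i⟩, ⟨hc, hi⟩, rfl⟩
    exact hi ⟨_, ⟨hc, rfl⟩, rfl⟩
  rcases Ultrafilter.union_mem_iff.1 hcover with h | h
  · exact .inl fun x hx => (hAB hx).resolve_right fun hxB =>
      (hUV.closure_left hV).notMem_of_mem_left (hclosure h hx) (hBV hxB)
  · exact .inr fun x hx => (hAB hx).resolve_left fun hxA =>
      (hUV.closure_right hU).notMem_of_mem_left (hAU hxA) (hclosure h hx)

theorem exists_mem_ultraCopower_inter_closure [CompactSpace Z] [T2Space Z] (u : Ultrafilter I)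
    {C : Set Z} {c : Z} (hc : c ∈ C) :
    ∃ x ∈ ultraCopower Z I u ∩ closure (stoneCechUnit '' (C ×ˢ (univ : Set I))),
      betaPiZ Z I x = c := by
  obtain ⟨x, -, hx⟩ := isCompact_univ.ultrafilter_le_nhds
    (u.map fun i => (stoneCechUnit (c, i) : StoneCech (Z × I))) (by simp)
  have hx : Tendsto (fun i => (stoneCechUnit (c, i) : StoneCech (Z × I))) u (𝓝 x) := hx
  refine ⟨x, ⟨?_, ?_⟩, ?_⟩
  · have h := (continuous_betaPiI.tendsto x).comp hx
    simp only [Function.comp_def, betaPiI_stoneCechUnit] at h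
    exact tendsto_nhds_unique h u.tendsto_pure_self
  · exact mem_closure_of_tendsto hx (.of_forall fun i => ⟨_, ⟨hc, mem_univ _⟩, rfl⟩)
  · have h := (continuous_betaPiZ.tendsto x).comp hx
    simp only [Function.comp_def, betaPiZ_stoneCechUnit] at h
    exact tendsto_nhds_unique h tendsto_const_nhds

end Ultracopower

/-- Co-diagonal maps are weakly confluent: if `Z` is a continuum, `I` a nonempty
discrete type, `u` an ultrafilter on `I` and `C ⊆ Z` a nonempty subcontinuum,
then the set `S = Z_u ∩ cl_{β(Z×I)}(ι(C × I))` is nonempty, lies in a single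
connected component of `q_u⁻¹(C) = Z_u ∩ βπ_Z⁻¹(C)`, and that component is
mapped onto `C` by the co-diagonal map. -/
theorem codiagonal_weakly_confluent (Z I : Type*) [TopologicalSpace Z] [CompactSpace Z]
    [T2Space Z] [ConnectedSpace Z] [TopologicalSpace I] [DiscreteTopology I] [Nonempty I]
    (u : Ultrafilter I) (C : Set Z) (hne : C.Nonempty) (hcomp : IsCompact C)
    (hconn : IsConnected C) :
    (ultraCopower Z I u ∩ closure (stoneCechUnit '' (C ×ˢ (univ : Set I)))).Nonempty ∧
    ∃ x ∈ ultraCopower Z I u ∩ closure (stoneCechUnit '' (C ×ˢ (univ : Set I))),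
      (ultraCopower Z I u ∩ closure (stoneCechUnit '' (C ×ˢ (univ : Set I)))) ⊆
        connectedComponentIn (ultraCopower Z I u ∩ betaPiZ Z I ⁻¹' C) x ∧
      betaPiZ Z I '' connectedComponentIn (ultraCopower Z I u ∩ betaPiZ Z I ⁻¹' C) x = C := by
  obtain ⟨c, hc⟩ := hne
  obtain ⟨x, hx, -⟩ := exists_mem_ultraCopower_inter_closure u hc
  have hsub := (isPreconnected_ultraCopower_inter_closure u
    hconn.isPreconnected).subset_connectedComponentIn hx
      (inter_subset_inter_right _ (closure_subset_preimage_betaPiZ hcomp.isClosed))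
  refine ⟨⟨x, hx⟩, x, hx, hsub, Subset.antisymm ?_ fun d hd => ?_⟩
  · rintro _ ⟨y, hy, rfl⟩
    exact (connectedComponentIn_subset _ _ hy).2
  · obtain ⟨y, hy, rfl⟩ := exists_mem_ultraCopower_inter_closure u hd
    exact ⟨y, hsub hy, rfl⟩
end

section
/- The point (1,0) is a cut point of Y at which Y fails to be connected im kleinen: Y \ {(1,0)} (with the subspace topology) is not connected, and there exists an open neighborhood U of (1,0) in Y such that no connected subset C ⊆ U contains (1,0) in its interior relative to Y. -/
open Set

lemma one_zero_mem_Yset : ((1:ℝ), (0:ℝ)) ∈ Yset := Or.inr ⟨by norm_num, by norm_num⟩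

/-- The point `(1,0)` of `Y`. -/
noncomputable def p₁₀ : ↥Yset := ⟨((1:ℝ), (0:ℝ)), one_zero_mem_Yset⟩

lemma mem_Yset_cases {p : ℝ × ℝ} (hp : p ∈ Yset) :
    p.2 = 0 ∨ p.1 ≤ 1 ∧ ∃ n : ℕ, p.2 = p.1 / 2 ^ n := by
  rcases hp with (h | h) | h
  · exact Or.inl h.2
  · obtain ⟨n, t, ht, rfl⟩ := mem_iUnion.1 h
    exact Or.inr ⟨ht.2, n, rfl⟩
  · exact Or.inl h.2

lemma hair_tip_mem_Yset (n : ℕ) : ((1 : ℝ), (1 : ℝ) / 2 ^ n) ∈ Yset :=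
  Or.inl (Or.inr (mem_iUnion.2 ⟨n, 1, by norm_num, rfl⟩))

lemma two_zero_mem_Yset : ((2 : ℝ), (0 : ℝ)) ∈ Yset :=
  Or.inr ⟨by norm_num, by norm_num⟩

lemma three_quarters_div_two_pow_ne (m n : ℕ) : (3 / 4 : ℝ) * (1 / 2 ^ n) ≠ 1 / 2 ^ m := by
  intro h
  field_simp at h
  have h' : 3 * 2 ^ m = 2 ^ (n + 2) := by
    have : (3 : ℝ) * 2 ^ m = 2 ^ (n + 2) := by rw [pow_add]; linarith
    exact_mod_cast this
  have hdvd : 3 ∣ 2 := Nat.prime_three.dvd_of_dvd_pow (Dvd.intro _ h')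
  omega

lemma continuous_Yset_fst : Continuous fun q : Yset => q.1.1 :=
  continuous_fst.comp continuous_subtype_val

lemma continuous_Yset_snd : Continuous fun q : Yset => q.1.2 :=
  continuous_snd.comp continuous_subtype_val

lemma not_isConnected_compl_p₁₀ : ¬ IsConnected ({p₁₀}ᶜ : Set ↥Yset) := by
  intro h
  have hright : IsOpen {q : Yset | 1 < q.1.1} :=
    isOpen_lt continuous_const continuous_Yset_fst
  have hleft : IsOpen ({q : Yset | q.1.1 < 1} ∪ {q : Yset | q.1.2 ≠ 0}) :=
    (isOpen_lt continuous_Yset_fst continuous_const).union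
      (isOpen_ne_fun continuous_Yset_snd continuous_const)
  obtain ⟨q, -, hq, hq'⟩ := h.isPreconnected _ _ hright hleft
    (by
      intro q hq
      rcases lt_trichotomy q.1.1 1 with hlt | heq | hgt
      · exact Or.inr (Or.inl hlt)
      · exact Or.inr (Or.inr fun h0 => hq (Subtype.ext (Prod.ext heq h0)))
      · exact Or.inl hgt)
    ⟨⟨_, two_zero_mem_Yset⟩, by simp [p₁₀], by simp⟩
    ⟨⟨_, hair_tip_mem_Yset 0⟩, by simp [p₁₀], Or.inr (by simp)⟩
  replace hq : 1 < q.1.1 := hq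
  rcases hq' with hlt | hne
  · exact lt_asymm hq hlt
  · rcases mem_Yset_cases q.2 with h0 | ⟨hle, -⟩
    · exact hne h0
    · exact hle.not_gt hq

lemma p₁₀_notMem_interior_of_isConnected {C : Set ↥Yset} (hCU : C ⊆ {q | 0 < q.1.1})
    (hC : IsConnected C) : p₁₀ ∉ interior C := by
  intro hp
  have htips : Filter.Tendsto (fun n : ℕ => (⟨_, hair_tip_mem_Yset n⟩ : Yset)) Filter.atTop
      (nhds p₁₀) := by
    refine tendsto_subtype_rng.2 (Filter.Tendsto.prodMk_nhds tendsto_const_nhds ?_)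
    simpa [Function.comp_def] using tendsto_inv_atTop_zero.comp
      (tendsto_pow_atTop_atTop_of_one_lt (one_lt_two : (1 : ℝ) < 2))
  obtain ⟨n, hn⟩ := (htips.eventually (mem_interior_iff_mem_nhds.1 hp)).exists
  have hslope : ContinuousOn (fun q : Yset => q.1.2 / q.1.1) C :=
    continuous_Yset_snd.continuousOn.div continuous_Yset_fst.continuousOn
      fun q hq => (hCU hq).ne'
  have hpos : (0 : ℝ) < 1 / 2 ^ n := by positivity
  obtain ⟨q, hq, hval⟩ := hC.isPreconnected.intermediate_value (interior_subset hp) hn hslope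
    (show (3 / 4 : ℝ) * (1 / 2 ^ n) ∈ _ by
      constructor <;> simp only [p₁₀, div_one] <;> linarith)
  have hq0 : 0 < q.1.1 := hCU hq
  simp only at hval
  rcases mem_Yset_cases q.2 with h0 | ⟨-, m, hm⟩
  · rw [h0, zero_div] at hval
    linarith
  · refine three_quarters_div_two_pow_ne m n ?_
    rw [← hval, hm]
    field_simp

/-- `(1,0)` is a cut point of `Y` at which `Y` fails to be connected im kleinen:
`Y \ {(1,0)}` is not connected, and there is an open neighbourhood `U` of `(1,0)`
in `Y` such that no connected subset `C ⊆ U` has `(1,0)` in its interior. -/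
theorem cutpoint_not_im_kleinen :
    ¬ IsConnected ({p₁₀}ᶜ : Set ↥Yset) ∧
    ∃ U : Set ↥Yset, IsOpen U ∧ p₁₀ ∈ U ∧
      ∀ C : Set ↥Yset, C ⊆ U → IsConnected C → p₁₀ ∉ interior C := by
  exact ⟨not_isConnected_compl_p₁₀, {q | 0 < q.1.1},
    isOpen_lt continuous_const continuous_Yset_fst, by simp [p₁₀],
    fun _ hCU hC => p₁₀_notMem_interior_of_isConnected hCU hC⟩
end

section
/- The continuum Y × [0,1] has no cut points: for every point p ∈ Y × [0,1], the space (Y × [0,1]) \ {p} (with the subspace topology) is connected. -/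
open Set

/-- Removing a point from the product of two nontrivial preconnected spaces leaves a
preconnected set. -/
theorem isPreconnected_compl_singleton_prod {X Z : Type*} [TopologicalSpace X]
    [TopologicalSpace Z] [PreconnectedSpace X] [PreconnectedSpace Z] [Nontrivial X]
    [Nontrivial Z] (p : X × Z) : IsPreconnected ({p}ᶜ : Set (X × Z)) := by
  obtain ⟨a, b⟩ := p
  obtain ⟨a', ha⟩ := exists_ne a
  obtain ⟨b', hb⟩ := exists_ne b
  have cross : ∀ x z, IsPreconnected (({x} : Set X) ×ˢ (univ : Set Z) ∪ univ ×ˢ {z}) :=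
    fun x z ↦ IsPreconnected.union (x, z) (by simp) (by simp)
      (isPreconnected_singleton.prod isPreconnected_univ)
      (isPreconnected_univ.prod isPreconnected_singleton)
  have cross_subset : ∀ x z, x ≠ a → z ≠ b →
      (({x} : Set X) ×ˢ (univ : Set Z) ∪ univ ×ˢ {z}) ⊆ {(a, b)}ᶜ := by
    rintro x z hx hz ⟨u, v⟩ h
    simp only [mem_union, mem_prod, mem_singleton_iff, mem_univ, and_true, true_and] at h
    simp only [mem_compl_iff, mem_singleton_iff, Prod.mk.injEq, not_and]
    rintro rfl rfl
    exact h.elim (fun h ↦ hx h.symm) (fun h ↦ hz h.symm)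
  refine isPreconnected_of_forall (a', b') ?_
  rintro ⟨x, z⟩ hxz
  by_cases hx : x = a
  · have hz : z ≠ b := fun hz ↦ hxz (by simp [hx, hz])
    exact ⟨_, cross_subset a' z ha hz, by simp, by simp, cross a' z⟩
  · exact ⟨_, cross_subset x b' hx hb, by simp, by simp, cross x b'⟩

theorem zero_mem_Yset : (0 : ℝ × ℝ) ∈ Yset :=
  Or.inl (Or.inl (by simp))

theorem starConvex_Yset : StarConvex ℝ 0 Yset := by
  rw [starConvex_zero_iff]
  rintro ⟨u, v⟩ h c hc₀ hc₁
  have axis : ∀ s : ℝ, 0 ≤ s → s ≤ 2 → ((s, 0) : ℝ × ℝ) ∈ Yset := fun s h₀ h₂ ↦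
    (le_total s 1).elim (fun h₁ ↦ Or.inl (Or.inl ⟨⟨h₀, h₁⟩, rfl⟩))
      (fun h₁ ↦ Or.inr ⟨⟨h₁, h₂⟩, rfl⟩)
  rcases h with (⟨⟨h₀, h₁⟩, hv⟩ | h) | ⟨⟨h₁, h₂⟩, hv⟩
  · obtain rfl : v = 0 := hv
    simp only at h₀ h₁
    simpa using axis (c * u) (by positivity) (by nlinarith)
  · obtain ⟨n, t, ⟨h₀, h₁⟩, ht⟩ := mem_iUnion.mp h
    rw [ht]
    refine Or.inl (Or.inr (mem_iUnion.mpr ⟨n, c * t, ⟨by positivity, by nlinarith⟩, ?_⟩))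
    simp [mul_div_assoc]
  · obtain rfl : v = 0 := hv
    simp only at h₁ h₂
    simpa using axis (c * u) (by positivity) (by nlinarith)

theorem isConnected_Yset : IsConnected Yset :=
  (starConvex_Yset.isPathConnected zero_mem_Yset).isConnected

theorem nontrivial_Yset : Yset.Nontrivial :=
  ⟨0, zero_mem_Yset, (1, 0), Or.inr (by simp), by simp [Prod.ext_iff]⟩

/-- The continuum `Y × [0,1]` has no cut points: removing any single point leaves
a connected space. -/
theorem Y_prod_unitInterval_no_cutpoints :
    ∀ p : ↥Yset × ↥(Icc (0:ℝ) 1), IsConnected ({p}ᶜ : Set (↥Yset × ↥(Icc (0:ℝ) 1))) := by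
  intro p
  have : ConnectedSpace Yset := isConnected_iff_connectedSpace.mp isConnected_Yset
  have : Nontrivial Yset := nontrivial_Yset.coe_sort
  have : PreconnectedSpace (Icc (0:ℝ) 1) :=
    isPreconnected_iff_preconnectedSpace.mp isPreconnected_Icc
  exact ⟨exists_ne p, isPreconnected_compl_singleton_prod p⟩
end
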